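/- Let (k_n) be a sequence of positive integers and θ_n : {0,1}^{k_n} → {0,1}^{k_n} bijections, and f the corresponding block-permutation map on binary expansions of [0,1]. Then f preserves the Lebesgue measure of every interval: λ(f([a,b])) = λ([a,b]) for all [a,b] ⊆ [0,1]. -/

import Mathlib

/-- `blockStart k n = k_1 + … + k_n`, the index where the `n`-th block begins. -/
def blockStart (k : ℕ → ℕ) (n : ℕ) : ℕ := ∑ i ∈ Finset.range n, k i

/-- The `j`-th binary digit of `x` (period-(0) convention for binary rationals). -/
noncomputable def bDigit (x : ℝ) (j : ℕ) : Fin 2 :=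
  ⟨(⌊x * 2 ^ (j + 1)⌋).toNat % 2, Nat.mod_lt _ (by norm_num)⟩

/-- The index of the block containing position `j`. -/
def blockOf (k : ℕ → ℕ) (j : ℕ) : ℕ :=
  Nat.findGreatest (fun m => blockStart k m ≤ j) j

/-- The pseudo-binary block-permutation map `f` determined by block lengths
`(k_n)` and block bijections `(θ_n)`: it applies `θ_n` to the `n`-th block of
`k_n` binary digits of `x` and reads off the resulting binary expansion
(`1` is sent to `1`). -/
noncomputable def pseudoF (k : ℕ → ℕ)
    (θ : ∀ n, (Fin (k n) → Fin 2) → (Fin (k n) → Fin 2)) (x : ℝ) : ℝ :=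
  if x = 1 then 1 else
    ∑' j : ℕ,
      if h : j - blockStart k (blockOf k j) < k (blockOf k j) then
        (((θ (blockOf k j)
            (fun i => bDigit x (blockStart k (blockOf k j) + i))
            ⟨j - blockStart k (blockOf k j), h⟩ : Fin 2) : ℕ) : ℝ) / 2 ^ (j + 1)
      else 0

open MeasureTheory

/-- The induced map on digit sequences. -/
def blockT (k : ℕ → ℕ)
    (θ : ∀ n, (Fin (k n) → Fin 2) → (Fin (k n) → Fin 2)) (α : ℕ → Fin 2) (j : ℕ) : Fin 2 :=
  if h : j - blockStart k (blockOf k j) < k (blockOf k j) then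
    θ (blockOf k j) (fun i => α (blockStart k (blockOf k j) + i))
      ⟨j - blockStart k (blockOf k j), h⟩
  else 0

lemma bDigit_eq (x : ℝ) (j : ℕ) : bDigit x j = Real.digits x 2 j := by
  apply Fin.ext
  simp [bDigit, Real.digits, Int.floor_toNat]

lemma pseudoF_eq (k : ℕ → ℕ) (θ : ∀ n, (Fin (k n) → Fin 2) → (Fin (k n) → Fin 2))
    (x : ℝ) (hx : x ≠ 1) :
    pseudoF k θ x = Real.ofDigits (blockT k θ (Real.digits x 2)) := by
  unfold pseudoF Real.ofDigits
  rw [if_neg hx]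
  apply tsum_congr
  intro j
  unfold Real.ofDigitsTerm blockT
  simp only [bDigit_eq]
  split_ifs with h
  · rw [div_eq_mul_inv]; norm_num
  · simp

lemma blockStart_succ (k : ℕ → ℕ) (n : ℕ) : blockStart k (n + 1) = blockStart k n + k n := by
  simp [blockStart, Finset.sum_range_succ]

lemma blockStart_mono (k : ℕ → ℕ) : Monotone (blockStart k) := by
  apply monotone_nat_of_le_succ
  intro n
  rw [blockStart_succ]; omega

lemma le_blockStart (k : ℕ → ℕ) (hk : ∀ n, 0 < k n) (n : ℕ) : n ≤ blockStart k n := by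
  induction n with
  | zero => simp
  | succ n ih => rw [blockStart_succ]; have := hk n; omega

lemma blockOf_eq (k : ℕ → ℕ) (hk : ∀ n, 0 < k n) (n i : ℕ) (hi : i < k n) :
    blockOf k (blockStart k n + i) = n := by
  unfold blockOf
  rw [Nat.findGreatest_eq_iff]
  refine ⟨?_, fun _ => by omega, ?_⟩
  · have := le_blockStart k hk n; omega
  · intro m hm _ h
    have := blockStart_mono k (show n + 1 ≤ m from hm)
    rw [blockStart_succ] at this
    omega

lemma exists_block (k : ℕ → ℕ) (N j : ℕ) (hj : j < blockStart k N) :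
    ∃ n < N, ∃ i < k n, j = blockStart k n + i := by
  induction N with
  | zero => simp [blockStart] at hj
  | succ N ih =>
    by_cases h : j < blockStart k N
    · obtain ⟨n, hn, i, hi, e⟩ := ih h
      exact ⟨n, by omega, i, hi, e⟩
    · rw [blockStart_succ] at hj
      exact ⟨N, by omega, j - blockStart k N, by omega, by omega⟩

lemma blockT_apply (k : ℕ → ℕ) (hk : ∀ n, 0 < k n)
    (θ : ∀ n, (Fin (k n) → Fin 2) → (Fin (k n) → Fin 2)) (α : ℕ → Fin 2) (n : ℕ)
    (i : Fin (k n)) :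
    blockT k θ α (blockStart k n + i) = θ n (fun i => α (blockStart k n + i)) i := by
  have key : ∀ m, m = n →
    (if h : (blockStart k n + i) - blockStart k m < k m then
      θ m (fun i => α (blockStart k m + i)) ⟨(blockStart k n + i) - blockStart k m, h⟩
     else 0) = θ n (fun i => α (blockStart k n + i)) i := by
    rintro m rfl
    simp
  exact key _ (blockOf_eq k hk n i i.2)

lemma blockT_inv (k : ℕ → ℕ) (hk : ∀ n, 0 < k n)
    (θ η : ∀ n, (Fin (k n) → Fin 2) → (Fin (k n) → Fin 2))
    (h : ∀ n x, θ n (η n x) = x) (α : ℕ → Fin 2) :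
    blockT k θ (blockT k η α) = α := by
  funext j
  obtain ⟨n, -, i, hi, rfl⟩ := exists_block k (j + 1) j (le_blockStart k hk (j + 1))
  have := blockT_apply k hk θ (blockT k η α) n ⟨i, hi⟩
  simp only at this
  rw [this]
  simp only [blockT_apply k hk η α n]
  have := congrFun (h n (fun i => α (blockStart k n + i))) ⟨i, hi⟩
  exact this

lemma blockT_congr (k : ℕ → ℕ) (hk : ∀ n, 0 < k n)
    (θ : ∀ n, (Fin (k n) → Fin 2) → (Fin (k n) → Fin 2)) (α β : ℕ → Fin 2) (N : ℕ)
    (h : ∀ j < blockStart k N, α j = β j) :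
    ∀ j < blockStart k N, blockT k θ α j = blockT k θ β j := by
  intro j hj
  obtain ⟨n, hn, i, hi, rfl⟩ := exists_block k N j hj
  have h1 := blockT_apply k hk θ α n ⟨i, hi⟩
  have h2 := blockT_apply k hk θ β n ⟨i, hi⟩
  simp only at h1 h2
  rw [h1, h2]
  have e : (fun i : Fin (k n) => α (blockStart k n + i)) = fun i : Fin (k n) => β (blockStart k n + i) := by
    funext i
    apply h
    have := blockStart_mono k (show n + 1 ≤ N from hn)
    rw [blockStart_succ] at this
    have := i.2
    omega
  rw [e]

lemma digits_congr (x y : ℝ) (s : ℕ) (h : ⌊x * 2 ^ s⌋₊ = ⌊y * 2 ^ s⌋₊) :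
    ∀ j < s, Real.digits x 2 j = Real.digits y 2 j := by
  intro j hj
  obtain ⟨d, rfl⟩ : ∃ d, s = (j + 1) + d := ⟨s - (j + 1), by omega⟩
  have key : ∀ z : ℝ, ⌊z * 2 ^ (j + 1)⌋₊ = ⌊z * 2 ^ (j + 1 + d)⌋₊ / 2 ^ d := by
    intro z
    rw [← Nat.floor_div_natCast]
    congr 1
    push_cast
    rw [pow_add _ (j + 1) d]
    field_simp
  apply Fin.ext
  simp only [Real.digits, Nat.cast_ofNat, key, h]

lemma ofDigits_step (α : ℕ → Fin 2) :
    Real.ofDigits α = ((α 0 : ℕ) + Real.ofDigits (fun i => α (i + 1))) / 2 := by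
  rw [Real.ofDigits_eq_sum_add_ofDigits α 1]
  simp [Real.ofDigitsTerm]
  ring

lemma ofDigits_lt_one (n : ℕ) : ∀ (α : ℕ → Fin 2), α n = 0 → Real.ofDigits α < 1 := by
  induction n with
  | zero =>
    intro α h
    have := Real.ofDigits_le_one (fun i => α (i + 1))
    rw [ofDigits_step, h]
    simp only [Fin.val_zero, Nat.cast_zero]
    linarith
  | succ n ih =>
    intro α h
    have := ih (fun i => α (i + 1)) h
    have h0 : ((α 0 : ℕ) : ℝ) ≤ 1 := by
      have := (α 0).2
      exact_mod_cast (by omega : (α 0 : ℕ) ≤ 1)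
    rw [ofDigits_step]
    linarith

lemma digits_ofDigits (α : ℕ → Fin 2) (h : ∀ n, ∃ j, α (j + n) = 0) :
    Real.digits (Real.ofDigits α) 2 = α := by
  have key : ∀ n, ∃ m : ℕ, Real.ofDigits α * 2 ^ n = m + Real.ofDigits (fun i => α (i + n)) := by
    intro n
    induction n with
    | zero => exact ⟨0, by simp⟩
    | succ n ih =>
      obtain ⟨m, hm⟩ := ih
      refine ⟨2 * m + α n, ?_⟩
      rw [pow_succ, ← mul_assoc, hm, ofDigits_step (fun i => α (i + n))]
      simp only [zero_add, add_assoc, add_comm 1 n]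
      push_cast
      ring
  funext n
  obtain ⟨m, hm⟩ := key n
  have h1 : Real.ofDigits α * 2 ^ (n + 1)
      = ((2 * m + α n : ℕ) : ℝ) + Real.ofDigits (fun i => α (i + (n + 1))) := by
    rw [pow_succ, ← mul_assoc, hm, ofDigits_step (fun i => α (i + n))]
    simp only [zero_add, add_assoc, add_comm 1 n]
    push_cast
    ring
  have h2 : ⌊Real.ofDigits α * 2 ^ (n + 1)⌋₊ = 2 * m + α n := by
    rw [h1]
    obtain ⟨j, hj⟩ := h (n + 1)
    have hlt := ofDigits_lt_one j (fun i => α (i + (n + 1))) hj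
    have hnn := Real.ofDigits_nonneg (fun i => α (i + (n + 1)))
    rw [Nat.floor_eq_iff (by positivity)]
    constructor <;> linarith
  apply Fin.ext
  simp only [Real.digits, Nat.cast_ofNat, h2, Fin.val_ofNat]
  have := (α n).2
  omega

lemma countable_bad : {α : ℕ → Fin 2 | ¬ ∀ n, ∃ j, α (j + n) = 0}.Countable := by
  have : {α : ℕ → Fin 2 | ¬ ∀ n, ∃ j, α (j + n) = 0} ⊆
      ⋃ n : ℕ, Set.range (fun (g : Fin n → Fin 2) (j : ℕ) =>
        if h : j < n then g ⟨j, h⟩ else (1 : Fin 2)) := by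
    intro α hα
    simp only [Set.mem_ofPred_eq, not_forall, not_exists] at hα
    obtain ⟨n, hn⟩ := hα
    refine Set.mem_iUnion.2 ⟨n, fun i => α i, ?_⟩
    funext j
    by_cases hj : j < n
    · simp [hj]
    · have := hn (j - n)
      rw [Nat.sub_add_cancel (by omega)] at this
      simp only [hj, dite_false]
      omega
  exact (Set.countable_iUnion fun n => Set.countable_range _).mono this

lemma full_cover (k : ℕ → ℕ) (hk : ∀ n, 0 < k n)
    (θ : ∀ n, (Fin (k n) → Fin 2) → (Fin (k n) → Fin 2))
    (hθ : ∀ n, Function.Bijective (θ n)) :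
    ∃ C : Set ℝ, C.Countable ∧ Set.Ico (0 : ℝ) 1 ⊆ pseudoF k θ '' Set.Icc 0 1 ∪ C := by
  choose η hη using fun n => (hθ n).2
  refine ⟨(fun α => Real.ofDigits (blockT k θ α)) '' _, countable_bad.image _, ?_⟩
  intro y hy
  have e := blockT_inv k hk θ η hη (Real.digits y 2)
  set α := blockT k η (Real.digits y 2) with hα
  by_cases h : ∀ n, ∃ j, α (j + n) = 0
  · left
    refine ⟨Real.ofDigits α, ⟨Real.ofDigits_nonneg _, Real.ofDigits_le_one _⟩, ?_⟩
    obtain ⟨j, hj⟩ := h 0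
    rw [pseudoF_eq _ _ _ (ofDigits_lt_one j α hj).ne, digits_ofDigits α h, e,
      Real.ofDigits_digits (by norm_num) hy]
  · right
    refine ⟨α, h, ?_⟩
    simp only [e]
    exact Real.ofDigits_digits (by norm_num) hy

lemma volume_image_le_aux (k : ℕ → ℕ) (hk : ∀ n, 0 < k n)
    (θ : ∀ n, (Fin (k n) → Fin 2) → (Fin (k n) → Fin 2))
    (a b : ℝ) (ha : 0 ≤ a) (hab : a ≤ b) (N : ℕ) :
    volume (pseudoF k θ '' Set.Icc a b) ≤ ENNReal.ofReal (b - a + 2 * (2⁻¹) ^ N) := by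
  set s := blockStart k N with hs
  set f := pseudoF k θ with hf
  let C : ℕ → Set ℝ := fun m => {x | x ≠ 1 ∧ ⌊x * 2 ^ s⌋₊ = m}
  let I := Finset.Icc ⌊a * 2 ^ s⌋₊ ⌊b * 2 ^ s⌋₊
  have hC : ∀ m, volume (f '' C m) ≤ ENNReal.ofReal ((2 ^ s)⁻¹) := by
    intro m
    refine (Real.volume_le_diam _).trans (Metric.ediam_le ?_)
    rintro _ ⟨x, hx, rfl⟩ _ ⟨y, hy, rfl⟩
    rw [edist_dist]
    apply ENNReal.ofReal_le_ofReal
    rw [Real.dist_eq, hf, pseudoF_eq _ _ _ hx.1, pseudoF_eq _ _ _ hy.1]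
    have := Real.abs_ofDigits_sub_ofDigits_le (blockT_congr k hk θ _ _ N
      (digits_congr x y s (hx.2.trans hy.2.symm)))
    exact_mod_cast this
  have hsub : f '' Set.Icc a b ⊆ {1} ∪ ⋃ m ∈ I, f '' C m := by
    rintro _ ⟨x, hx, rfl⟩
    by_cases h1 : x = 1
    · left; simp [hf, pseudoF, h1]
    · right
      simp only [Set.mem_iUnion]
      refine ⟨⌊x * 2 ^ s⌋₊, ?_, x, ⟨h1, rfl⟩, rfl⟩
      rw [Finset.mem_Icc]
      constructor
      · apply Nat.floor_le_floor
        have := hx.1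
        gcongr
      · apply Nat.floor_le_floor
        have := hx.2
        gcongr
  have hfl : ⌊a * 2 ^ s⌋₊ ≤ ⌊b * 2 ^ s⌋₊ := by
    apply Nat.floor_le_floor
    gcongr
  have hcard : (I.card : ℝ) ≤ (b - a) * 2 ^ s + 2 := by
    have h1 : I.card + ⌊a * 2 ^ s⌋₊ = ⌊b * 2 ^ s⌋₊ + 1 := by
      simp only [I, Nat.card_Icc]; omega
    have h1' : (I.card : ℝ) + ⌊a * 2 ^ s⌋₊ = ⌊b * 2 ^ s⌋₊ + 1 := by exact_mod_cast h1
    have h2 := Nat.lt_floor_add_one (a * 2 ^ s)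
    have h3 := Nat.floor_le (a := b * 2 ^ s) (by have := ha.trans hab; positivity)
    linarith
  calc volume (f '' Set.Icc a b) ≤ volume ({1} ∪ ⋃ m ∈ I, f '' C m) := measure_mono hsub
    _ ≤ volume {(1 : ℝ)} + volume (⋃ m ∈ I, f '' C m) := measure_union_le _ _
    _ = volume (⋃ m ∈ I, f '' C m) := by simp
    _ ≤ ∑ m ∈ I, volume (f '' C m) := measure_biUnion_finset_le _ _
    _ ≤ ∑ m ∈ I, ENNReal.ofReal ((2 ^ s)⁻¹) := Finset.sum_le_sum fun m _ => hC m
    _ = ENNReal.ofReal (I.card * (2 ^ s)⁻¹) := by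
      rw [Finset.sum_const, nsmul_eq_mul, ENNReal.ofReal_mul (by positivity),
        ENNReal.ofReal_natCast]
    _ ≤ ENNReal.ofReal (b - a + 2 * (2⁻¹) ^ N) := by
      apply ENNReal.ofReal_le_ofReal
      calc (I.card : ℝ) * (2 ^ s)⁻¹ ≤ ((b - a) * 2 ^ s + 2) * (2 ^ s)⁻¹ := by gcongr
        _ = b - a + 2 * (2⁻¹) ^ s := by rw [inv_pow]; field_simp
        _ ≤ b - a + 2 * (2⁻¹) ^ N := by
          have := pow_le_pow_of_le_one (a := (2⁻¹ : ℝ)) (by norm_num) (by norm_num)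
            (le_blockStart k hk N)
          linarith

lemma volume_image_le (k : ℕ → ℕ) (hk : ∀ n, 0 < k n)
    (θ : ∀ n, (Fin (k n) → Fin 2) → (Fin (k n) → Fin 2))
    (a b : ℝ) (ha : 0 ≤ a) (hab : a ≤ b) :
    volume (pseudoF k θ '' Set.Icc a b) ≤ ENNReal.ofReal (b - a) := by
  have ht : Filter.Tendsto (fun N : ℕ => ENNReal.ofReal (b - a + 2 * (2⁻¹) ^ N)) Filter.atTop
      (nhds (ENNReal.ofReal (b - a))) := by
    apply ENNReal.tendsto_ofReal
    have := (tendsto_pow_atTop_nhds_zero_of_lt_one (r := (2⁻¹ : ℝ)) (by norm_num)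
      (by norm_num)).const_mul 2 |>.const_add (b - a)
    simpa using this
  exact ge_of_tendsto' ht fun N => volume_image_le_aux k hk θ a b ha hab N

/-- The block-permutation map `f` preserves the Lebesgue measure of every
interval `[a,b] ⊆ [0,1]`. -/
theorem pseudoF_preserves_measure (k : ℕ → ℕ) (hk : ∀ n, 0 < k n)
    (θ : ∀ n, (Fin (k n) → Fin 2) → (Fin (k n) → Fin 2))
    (hθ : ∀ n, Function.Bijective (θ n))
    (a b : ℝ) (ha : 0 ≤ a) (hab : a ≤ b) (hb : b ≤ 1) :
    volume (pseudoF k θ '' Set.Icc a b) = volume (Set.Icc a b) := by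
  rw [Real.volume_Icc]
  have h2 := volume_image_le k hk θ a b ha hab
  apply le_antisymm h2
  have h1 := volume_image_le k hk θ 0 a le_rfl ha
  have h3 := volume_image_le k hk θ b 1 (ha.trans hab) hb
  obtain ⟨C, hC, hcov⟩ := full_cover k hk θ hθ
  have hsub : Set.Ico (0 : ℝ) 1 ⊆ (pseudoF k θ '' Set.Icc 0 a ∪ pseudoF k θ '' Set.Icc a b) ∪
      pseudoF k θ '' Set.Icc b 1 ∪ C := by
    rwa [← Set.image_union, ← Set.image_union, Set.Icc_union_Icc_eq_Icc ha hab,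
      Set.Icc_union_Icc_eq_Icc (ha.trans hab) hb]
  have h4 : ENNReal.ofReal 1 ≤ ENNReal.ofReal (a - 0) + volume (pseudoF k θ '' Set.Icc a b)
      + ENNReal.ofReal (1 - b) := by
    calc ENNReal.ofReal 1 = volume (Set.Ico (0 : ℝ) 1) := by simp
      _ ≤ _ := measure_mono hsub
      _ ≤ _ := measure_union_le _ _
      _ = _ := by rw [hC.measure_zero, add_zero]
      _ ≤ _ := measure_union_le _ _
      _ ≤ _ := add_le_add (measure_union_le _ _) le_rfl
      _ ≤ _ := by gcongr
  have hfin : volume (pseudoF k θ '' Set.Icc a b) ≠ ⊤ := (h2.trans_lt ENNReal.ofReal_lt_top).ne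
  rw [← ENNReal.ofReal_toReal hfin] at h4 ⊢
  have hn := ENNReal.toReal_nonneg (a := volume (pseudoF k θ '' Set.Icc a b))
  rw [← ENNReal.ofReal_add (by linarith) hn, ← ENNReal.ofReal_add (by linarith) (by linarith),
    ENNReal.ofReal_le_ofReal_iff (by linarith)] at h4
  apply ENNReal.ofReal_le_ofReal
  linarith
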